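/- Strict majorization gives an exact Cauchy representation. Let n ≥ 1 and let x : Fin n → ℝ be monotone increasing with ∑_{i=0}^{k−1} x i > k(k−1)/2 for every 1 ≤ k ≤ n−1 and ∑_{i=0}^{n−1} x i = n(n−1)/2. Then there exists α : Fin n → ℝ such that x i = ∑_{j ≠ i} C(α i − α j) for every i, where C(u) = 1/2 + arctan(u)/π. -/

import Mathlib

/-- The standard Cauchy distribution function `C(u) = 1/2 + arctan(u)/π`. -/
noncomputable def cauchyC (u : ℝ) : ℝ := 1 / 2 + Real.arctan u / Real.pi

/-- The even primitive of `arctan u / π`. -/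
noncomputable def arctanPotential (u : ℝ) : ℝ :=
  (u * Real.arctan u - Real.log (1 + u ^ 2) / 2) / Real.pi

theorem hasDerivAt_arctanPotential (u : ℝ) :
    HasDerivAt arctanPotential (Real.arctan u / Real.pi) u := by
  have hpos : (1 : ℝ) + u ^ 2 ≠ 0 := by positivity
  have hlog : HasDerivAt (fun u : ℝ => Real.log (1 + u ^ 2)) (2 * u / (1 + u ^ 2)) u := by
    have h : HasDerivAt (fun u : ℝ => 1 + u ^ 2) (2 * u) u := by
      simpa using (hasDerivAt_pow 2 u).const_add 1
    exact h.log hpos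
  have h := ((((hasDerivAt_id u).mul (Real.hasDerivAt_arctan u)).sub
    (hlog.div_const 2)).div_const Real.pi)
  refine h.congr_deriv ?_
  simp only [id]
  congr 1
  field_simp
  ring

theorem arctanPotential_neg (u : ℝ) : arctanPotential (-u) = arctanPotential u := by
  simp [arctanPotential, Real.arctan_neg]

theorem continuous_arctanPotential : Continuous arctanPotential :=
  continuous_iff_continuousAt.2 fun u => (hasDerivAt_arctanPotential u).continuousAt

theorem exists_mul_abs_sub_le_arctanPotential {c : ℝ} (hc₀ : 0 ≤ c) (hc : c < 1 / 2) :
    ∃ K, ∀ u, c * |u| - K ≤ arctanPotential u := by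
  have hpi := Real.pi_pos
  set T := Real.tan (c * Real.pi)
  have hT : Real.arctan T = c * Real.pi :=
    Real.arctan_tan (by nlinarith) (by nlinarith)
  have hd (u : ℝ) : HasDerivAt (fun u => arctanPotential u - c * u)
      (Real.arctan u / Real.pi - c) u :=
    ((hasDerivAt_arctanPotential u).sub ((hasDerivAt_id u).const_mul c)).congr_deriv (by simp)
  have hcont : Continuous fun u => arctanPotential u - c * u :=
    continuous_arctanPotential.sub (continuous_const.mul continuous_id)
  have key (u : ℝ) : arctanPotential T - c * T ≤ arctanPotential u - c * u := by
    rcases le_total T u with h | h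
    · refine monotoneOn_of_deriv_nonneg (convex_Ici T) hcont.continuousOn
        (fun v _ => (hd v).differentiableAt.differentiableWithinAt) (fun v hv => ?_)
        (Set.self_mem_Ici) h h
      rw [interior_Ici, Set.mem_Ioi] at hv
      rw [(hd v).deriv, sub_nonneg, le_div_iff₀ hpi, ← hT]
      exact Real.arctan_strictMono.monotone hv.le
    · refine antitoneOn_of_deriv_nonpos (convex_Iic T) hcont.continuousOn
        (fun v _ => (hd v).differentiableAt.differentiableWithinAt) (fun v hv => ?_)
        h (Set.self_mem_Iic) h
      rw [interior_Iic, Set.mem_Iio] at hv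
      rw [(hd v).deriv, sub_nonpos, div_le_iff₀ hpi, ← hT]
      exact Real.arctan_strictMono.monotone hv.le
  refine ⟨c * T - arctanPotential T, fun u => ?_⟩
  rcases abs_cases u with ⟨h, -⟩ | ⟨h, -⟩ <;> rw [h]
  · linarith [key u]
  · linarith [key (-u), arctanPotential_neg u]

theorem intervalIntegral_indicator_le {a R : ℝ} (h₁ : -R ≤ a) (h₂ : a ≤ R) :
    ∫ t in (-R)..R, (if a ≤ t then (1 : ℝ) else 0) = R - a := by
  have : (fun t => if a ≤ t then (1 : ℝ) else 0) = (Set.Ici a).indicator 1 := by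
    ext t; simp [Set.indicator_apply]
  rw [intervalIntegral.integral_of_le (h₁.trans h₂), this,
    MeasureTheory.integral_indicator_one measurableSet_Ici,
    MeasureTheory.measureReal_restrict_apply measurableSet_Ici,
    MeasureTheory.measureReal_congr (t := Set.Ioc a R)]
  · simp [h₂]
  have h : (Set.Ioi a ∩ Set.Ioc (-R) R : Set ℝ) = Set.Ioc a R := by
    ext t; simp only [Set.mem_inter_iff, Set.mem_Ioi, Set.mem_Ioc]
    constructor
    · rintro ⟨h, -, h'⟩; exact ⟨h, h'⟩
    · rintro ⟨h, h'⟩; exact ⟨h, by linarith, h'⟩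
  rw [← h]
  exact MeasureTheory.Ioi_ae_eq_Ici.symm.inter (Filter.EventuallyEq.refl _ _)

theorem mul_sub_le_sum_abs_sub_of_forall_finset {ι : Type*} [Fintype ι] {y : ι → ℝ} {δ : ℝ}
    (hy : ∑ i, y i = 0)
    (hδ : ∀ S : Finset ι, S.Nonempty → S ≠ Finset.univ →
      δ ≤ (S.card : ℝ) * (Fintype.card ι - S.card) / 2 + ∑ i ∈ S, y i)
    (hδ₀ : 0 ≤ δ) (α : ι → ℝ) (p q : ι) :
    δ * (α p - α q) ≤ (∑ i, ∑ j, |α i - α j|) / 4 - ∑ i, y i * α i := by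
  set f : ℝ → ℝ → ℝ := fun a t => if a ≤ t then 1 else 0
  have hint (a b c : ℝ) : IntervalIntegrable (f a) MeasureTheory.volume b c := by
    apply Monotone.intervalIntegrable
    intro s t hst
    simp only [f]
    split_ifs with h₁ h₂
    exacts [le_rfl, absurd (h₁.trans hst) h₂, zero_le_one, le_rfl]
  obtain ⟨R, hR⟩ : ∃ R, ∀ i, -R ≤ α i ∧ α i ≤ R :=
    ⟨‖α‖, fun i => abs_le.1 (norm_le_pi_norm α i)⟩
  have hval (i : ι) : ∫ t in (-R)..R, f (α i) t = R - α i :=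
    intervalIntegral_indicator_le (hR i).1 (hR i).2
  have hval' (i j : ι) : ∫ t in (-R)..R, f (max (α i) (α j)) t = R - max (α i) (α j) :=
    intervalIntegral_indicator_le (le_max_of_le_left (hR i).1) (max_le (hR i).2 (hR j).2)
  have hpt (t : ℝ) : δ * (f (α q) t - f (α p) t) ≤
      (∑ i, ∑ j, (f (α i) t + f (α j) t - 2 * f (max (α i) (α j)) t)) / 4
        + ∑ i, y i * f (α i) t := by
    set S := Finset.univ.filter fun i => α i ≤ t with hS
    have hcard : ∑ i, f (α i) t = S.card := by simp [f, hS]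
    have hsum : ∑ i, y i * f (α i) t = ∑ i ∈ S, y i := by simp [f, hS, Finset.sum_filter]
    have hmax (i j : ι) : f (max (α i) (α j)) t = f (α i) t * f (α j) t := by
      simp only [f, max_le_iff]; split_ifs <;> simp_all
    have hdouble : (∑ i, ∑ j, (f (α i) t + f (α j) t - 2 * f (max (α i) (α j)) t)) / 4
        = (S.card : ℝ) * (Fintype.card ι - S.card) / 2 := by
      simp only [hmax, Finset.sum_sub_distrib, Finset.sum_add_distrib, ← Finset.mul_sum,
        ← Finset.sum_mul, hcard, Finset.sum_const, Finset.card_univ, nsmul_eq_mul]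
      ring
    rw [hdouble, hsum]
    rcases S.eq_empty_or_nonempty with h | h
    · have (i : ι) : ¬ α i ≤ t := by
        intro hi
        have : i ∈ S := by simp [hS, hi]
        simp [h] at this
      simp [f, this, h]
    by_cases h' : S = Finset.univ
    · have (i : ι) : α i ≤ t := by
        have : i ∈ S := by simp [h']
        simpa [hS] using this
      simp [f, this, h', hy]
    · refine le_trans ?_ (hδ S h h')
      have : f (α q) t - f (α p) t ≤ 1 := by simp only [f]; split_ifs <;> norm_num
      nlinarith
  have hRR : -R ≤ R := (hR p).1.trans (hR p).2
  have hL : IntervalIntegrable (fun t => δ * (f (α q) t - f (α p) t))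
      MeasureTheory.volume (-R) R := ((hint _ _ _).sub (hint _ _ _)).const_mul δ
  have hij (i j : ι) : IntervalIntegrable
      (fun t => f (α i) t + f (α j) t - 2 * f (max (α i) (α j)) t)
      MeasureTheory.volume (-R) R :=
    ((hint _ _ _).add (hint _ _ _)).sub ((hint _ _ _).const_mul 2)
  have hrow (i : ι) : IntervalIntegrable
      (fun t => ∑ j, (f (α i) t + f (α j) t - 2 * f (max (α i) (α j)) t))
      MeasureTheory.volume (-R) R := by
    simpa only [Finset.sum_fn] using IntervalIntegrable.sum Finset.univ fun j _ => hij i j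
  have hdbl : IntervalIntegrable
      (fun t => (∑ i, ∑ j, (f (α i) t + f (α j) t - 2 * f (max (α i) (α j)) t)) / 4)
      MeasureTheory.volume (-R) R := by
    refine IntervalIntegrable.div_const ?_ 4
    simpa only [Finset.sum_fn] using IntervalIntegrable.sum Finset.univ fun i _ => hrow i
  have hlin : IntervalIntegrable (fun t => ∑ i, y i * f (α i) t)
      MeasureTheory.volume (-R) R := by
    simpa only [Finset.sum_fn] using
      IntervalIntegrable.sum Finset.univ fun i _ => (hint (α i) (-R) R).const_mul (y i)
  have hmono := intervalIntegral.integral_mono_on hRR hL (hdbl.add hlin) fun t _ => hpt t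
  rw [intervalIntegral.integral_const_mul, intervalIntegral.integral_sub (hint _ _ _) (hint _ _ _),
    hval, hval, intervalIntegral.integral_add hdbl hlin, intervalIntegral.integral_div,
    intervalIntegral.integral_finsetSum fun i _ => hrow i,
    intervalIntegral.integral_finsetSum fun i _ => (hint (α i) (-R) R).const_mul (y i)] at hmono
  have hcell (i j : ι) : ∫ t in (-R)..R, (f (α i) t + f (α j) t - 2 * f (max (α i) (α j)) t)
      = |α i - α j| := by
    rw [intervalIntegral.integral_sub ((hint _ _ _).add (hint _ _ _)) ((hint _ _ _).const_mul 2),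
      intervalIntegral.integral_add (hint _ _ _) (hint _ _ _),
      intervalIntegral.integral_const_mul, hval, hval, hval', ← max_sub_min_eq_abs']
    linarith [max_add_min (α i) (α j)]
  have hrowval (i : ι) :
      ∫ t in (-R)..R, (∑ j, (f (α i) t + f (α j) t - 2 * f (max (α i) (α j)) t))
        = ∑ j, |α i - α j| := by
    rw [intervalIntegral.integral_finsetSum fun j _ => hij i j]
    exact Finset.sum_congr rfl fun j _ => hcell i j
  simp only [hrowval] at hmono
  simp only [intervalIntegral.integral_const_mul, hval, mul_sub, Finset.sum_sub_distrib,
    ← Finset.sum_mul, hy] at hmono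
  linarith

theorem Monotone.sum_filter_lt_card_le {n : ℕ} {x : Fin n → ℝ} (hx : Monotone x)
    (S : Finset (Fin n)) :
    ∑ i ∈ Finset.univ.filter (fun i : Fin n => (i : ℕ) < S.card), x i ≤ ∑ i ∈ S, x i := by
  have hSn : S.card ≤ n := by simpa using S.card_le_univ
  have hle (m : ℕ) (hm : m < S.card) : m ≤ (S.orderEmbOfFin rfl ⟨m, hm⟩ : ℕ) := by
    induction m with
    | zero => exact Nat.zero_le _
    | succ m ih =>
      have h : S.orderEmbOfFin rfl ⟨m, by omega⟩ < S.orderEmbOfFin rfl ⟨m + 1, hm⟩ :=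
        (S.orderEmbOfFin rfl).strictMono (by simp [Fin.lt_def])
      have := ih (by omega)
      rw [Fin.lt_def] at h
      omega
  have hinit : Finset.univ.filter (fun i : Fin n => (i : ℕ) < S.card)
      = Finset.univ.map (Fin.castLEEmb hSn) := by
    ext i
    simp only [Finset.mem_filter, Finset.mem_univ, true_and, Finset.mem_map, Fin.castLEEmb_apply]
    exact ⟨fun h => ⟨⟨i, h⟩, rfl⟩, by rintro ⟨j, rfl⟩; exact j.2⟩
  have hS : S = Finset.univ.map (S.orderEmbOfFin rfl).toEmbedding := by simp
  rw [hinit, Finset.sum_map]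
  conv_rhs => rw [hS, Finset.sum_map]
  exact Finset.sum_le_sum fun j _ => hx (hle j j.2)

/-- A convex function whose critical points solve the score equations; the last term
removes the invariance under translation by constants. -/
noncomputable def scoreEnergy {ι : Type*} [Fintype ι] (y α : ι → ℝ) : ℝ :=
  (∑ i, ∑ j, arctanPotential (α i - α j)) / 2 - ∑ i, y i * α i + (∑ i, α i) ^ 2 / 2

theorem continuous_scoreEnergy {ι : Type*} [Fintype ι] (y : ι → ℝ) :
    Continuous (scoreEnergy y) := by
  have h := continuous_arctanPotential
  unfold scoreEnergy
  fun_prop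

theorem tendsto_scoreEnergy_cocompact {ι : Type*} [Fintype ι] [Nonempty ι] {y : ι → ℝ} {δ : ℝ}
    (hy : ∑ i, y i = 0) (hδ₀ : 0 < δ)
    (hδ : ∀ S : Finset ι, S.Nonempty → S ≠ Finset.univ →
      δ ≤ (S.card : ℝ) * (Fintype.card ι - S.card) / 2 + ∑ i ∈ S, y i) :
    Filter.Tendsto (scoreEnergy y) (Filter.cocompact (ι → ℝ)) Filter.atTop := by
  set N : ℝ := (Fintype.card ι : ℝ)
  have hN : 1 ≤ N := Nat.one_le_cast.2 Fintype.card_pos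
  have hN2 : 0 < N ^ 2 := by positivity
  set e := min (1 / 2) (δ / N ^ 2)
  have he₀ : 0 < e := lt_min (by norm_num) (by positivity)
  have he₁ : e ≤ 1 / 2 := min_le_left _ _
  have he₂ : e * N ^ 2 ≤ δ := (le_div_iff₀ hN2).1 (min_le_right _ _)
  obtain ⟨K, hK⟩ := exists_mul_abs_sub_le_arctanPotential (c := 1 / 2 - e)
    (by linarith) (by linarith)
  set m := min (δ / 2) 1
  have hm : 0 < m := lt_min (by positivity) one_pos
  refine Filter.tendsto_atTop_mono (f := fun α => m * ‖α‖ + -(N ^ 2 * K / 2 + 1 / 2))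
    (fun α => ?_) (Filter.tendsto_atTop_add_const_right _ _
      ((tendsto_norm_cocompact_atTop (E := ι → ℝ)).const_mul_atTop hm))
  obtain ⟨p, hp⟩ := Finite.exists_max α
  obtain ⟨q, hq⟩ := Finite.exists_min α
  set s := ∑ i, α i with hs
  set r := α p - α q
  have hr : 0 ≤ r := sub_nonneg.2 (hp q)
  have hsp : s ≤ N * α p := by
    simpa [N, nsmul_eq_mul] using Finset.sum_le_card_nsmul Finset.univ α (α p) fun i _ => hp i
  have hsq : N * α q ≤ s := by
    simpa [N, nsmul_eq_mul] using Finset.card_nsmul_le_sum Finset.univ α (α q) fun i _ => hq i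
  have hq' : α q ≤ |s| := by
    by_contra! h
    nlinarith [le_abs_self s, abs_nonneg s]
  have hp' : -|s| ≤ α p := by
    by_contra! h
    nlinarith [neg_abs_le s, abs_nonneg s]
  have hnorm : ‖α‖ ≤ r + |s| := by
    refine (pi_norm_le_iff_of_nonneg (by positivity)).2 fun i => abs_le.2 ⟨?_, ?_⟩
    · linarith [hq i]
    · linarith [hp i]
  have hsum_le : ∑ i, ∑ j, |α i - α j| ≤ N ^ 2 * r := by
    have h (i j : ι) : |α i - α j| ≤ r :=
      abs_le.2 ⟨by linarith [hp j, hq i], by linarith [hp i, hq j]⟩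
    calc ∑ i, ∑ j, |α i - α j| ≤ ∑ _i : ι, ∑ _j : ι, r :=
          Finset.sum_le_sum fun i _ => Finset.sum_le_sum fun j _ => h i j
      _ = N ^ 2 * r := by simp [N]; ring
  have hpot : (1 / 2 - e) * (∑ i, ∑ j, |α i - α j|) - N ^ 2 * K
      ≤ ∑ i, ∑ j, arctanPotential (α i - α j) := by
    calc (1 / 2 - e) * (∑ i, ∑ j, |α i - α j|) - N ^ 2 * K
        = ∑ i, ∑ j, ((1 / 2 - e) * |α i - α j| - K) := by
          simp [N, Finset.mul_sum, Finset.sum_sub_distrib]; ring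
      _ ≤ _ := Finset.sum_le_sum fun i _ => Finset.sum_le_sum fun j _ => hK _
  have hlin := mul_sub_le_sum_abs_sub_of_forall_finset hy hδ hδ₀.le α p q
  have hsq' : |s| - 1 / 2 ≤ s ^ 2 / 2 := by nlinarith [sq_nonneg (|s| - 1), sq_abs s]
  have hm₁ : m * r ≤ δ / 2 * r := by gcongr; exact min_le_left _ _
  have hm₂ : m * |s| ≤ |s| := mul_le_of_le_one_left (abs_nonneg s) (min_le_right _ _)
  have hm₃ : m * ‖α‖ ≤ m * (r + |s|) := by gcongr
  have h₁ : e * (∑ i, ∑ j, |α i - α j|) ≤ e * (N ^ 2 * r) := by gcongr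
  have h₂ : e * N ^ 2 * r ≤ δ * r := by gcongr
  simp only [scoreEnergy, ← hs]
  linarith

theorem hasDerivAt_scoreEnergy_line {ι : Type*} [Fintype ι] (y α v : ι → ℝ) :
    HasDerivAt (fun t : ℝ => scoreEnergy y (α + t • v))
      (∑ i, v i * (∑ j, Real.arctan (α i - α j) / Real.pi - y i)
        + (∑ i, α i) * ∑ i, v i) 0 := by
  have hcoord (i : ι) : HasDerivAt (fun t : ℝ => (α + t • v) i) (v i) 0 := by
    simpa using ((hasDerivAt_id (0 : ℝ)).mul_const (v i)).const_add (α i)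
  have hpair (i j : ι) : HasDerivAt
      (fun t : ℝ => arctanPotential ((α + t • v) i - (α + t • v) j))
      (Real.arctan (α i - α j) / Real.pi * (v i - v j)) 0 :=
    HasDerivAt.comp (0 : ℝ) (h₂ := arctanPotential)
      (by simpa using hasDerivAt_arctanPotential (α i - α j)) ((hcoord i).sub (hcoord j))
  have h := (((HasDerivAt.fun_sum (u := Finset.univ) fun i _ =>
      HasDerivAt.fun_sum (u := Finset.univ) fun j _ => hpair i j).div_const 2).sub
    (HasDerivAt.fun_sum (u := Finset.univ) fun i _ => (hcoord i).const_mul (y i))).add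
    (((HasDerivAt.fun_sum (u := Finset.univ) fun i _ => hcoord i).pow 2).div_const 2)
  refine h.congr_deriv ?_
  have hodd : ∑ i, ∑ j, Real.arctan (α i - α j) / Real.pi * v j
      = -∑ i, ∑ j, Real.arctan (α i - α j) / Real.pi * v i := by
    rw [Finset.sum_comm, ← Finset.sum_neg_distrib]
    refine Finset.sum_congr rfl fun i _ => ?_
    rw [← Finset.sum_neg_distrib]
    refine Finset.sum_congr rfl fun j _ => ?_
    rw [← neg_sub (α i), Real.arctan_neg]
    ring
  have hmain : ∑ i, v i * (∑ j, Real.arctan (α i - α j) / Real.pi - y i)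
      = ∑ i, ∑ j, Real.arctan (α i - α j) / Real.pi * v i - ∑ i, y i * v i := by
    rw [← Finset.sum_sub_distrib]
    refine Finset.sum_congr rfl fun i _ => ?_
    rw [← Finset.sum_mul]
    ring
  simp only [mul_sub (Real.arctan _ / Real.pi), Finset.sum_sub_distrib, hodd]
  rw [hmain]
  simp
  ring

theorem exists_sum_arctan_sub_eq {ι : Type*} [Fintype ι] [Nonempty ι] {y : ι → ℝ}
    (hy : ∑ i, y i = 0)
    (hpos : ∀ S : Finset ι, S.Nonempty → S ≠ Finset.univ →
      0 < (S.card : ℝ) * (Fintype.card ι - S.card) / 2 + ∑ i ∈ S, y i) :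
    ∃ α : ι → ℝ, ∀ i, y i = ∑ j, Real.arctan (α i - α j) / Real.pi := by
  classical
  obtain ⟨δ, hδ₀, hδ⟩ : ∃ δ > 0, ∀ S : Finset ι, S.Nonempty → S ≠ Finset.univ →
      δ ≤ (S.card : ℝ) * (Fintype.card ι - S.card) / 2 + ∑ i ∈ S, y i := by
    rcases (Finset.univ.filter fun S : Finset ι =>
      S.Nonempty ∧ S ≠ Finset.univ).eq_empty_or_nonempty with h | h
    · refine ⟨1, one_pos, fun S h₁ h₂ => ?_⟩
      have := (Finset.filter_eq_empty_iff.1 h) (Finset.mem_univ S)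
      exact absurd ⟨h₁, h₂⟩ this
    · obtain ⟨S, hS, hmin⟩ := Finset.exists_min_image _ (fun S : Finset ι =>
        (S.card : ℝ) * (Fintype.card ι - S.card) / 2 + ∑ i ∈ S, y i) h
      obtain ⟨h₁, h₂⟩ := (Finset.mem_filter.1 hS).2
      exact ⟨_, hpos S h₁ h₂, fun S' h₁' h₂' => hmin S' (by simp [h₁', h₂'])⟩
  obtain ⟨α, hα⟩ := (continuous_scoreEnergy y).exists_forall_le
    (tendsto_scoreEnergy_cocompact hy hδ₀ hδ)
  have hcrit (v : ι → ℝ) : ∑ i, v i * (∑ j, Real.arctan (α i - α j) / Real.pi - y i)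
      + (∑ i, α i) * ∑ i, v i = 0 :=
    IsLocalMin.hasDerivAt_eq_zero (Filter.Eventually.of_forall fun t => by simpa using hα _)
      (hasDerivAt_scoreEnergy_line y α v)
  have hodd : ∑ i, ∑ j, Real.arctan (α i - α j) / Real.pi = 0 := by
    refine self_eq_neg.1 ?_
    conv_lhs => rw [Finset.sum_comm]
    simp only [← Finset.sum_neg_distrib, ← neg_div, ← Real.arctan_neg, neg_sub]
  have hmean : ∑ i, α i = 0 := by
    simpa [Finset.sum_sub_distrib, hodd, hy] using hcrit 1
  refine ⟨α, fun i => ?_⟩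
  have := hcrit (Pi.single i 1)
  simp only [hmean, zero_mul, add_zero, Pi.single_apply, ite_mul, one_mul, Finset.sum_ite_eq',
    Finset.mem_univ, if_true] at this
  linarith


/-- If the monotone vector `x` is strictly majorized by `(0,1,…,n-1)`, then
`x` is exactly the mean score sequence of a Cauchy matrix. -/
theorem strict_majorization_cauchy (n : ℕ) (hn : 1 ≤ n)
    (x : Fin n → ℝ) (hx : Monotone x)
    (hstrict : ∀ k : ℕ, 1 ≤ k → k ≤ n - 1 →
      ((k * (k - 1) : ℕ) : ℝ) / 2 <
        ∑ i ∈ Finset.univ.filter (fun i : Fin n => (i : ℕ) < k), x i)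
    (htotal : ∑ i, x i = ((n * (n - 1) : ℕ) : ℝ) / 2) :
    ∃ α : Fin n → ℝ, ∀ i,
      x i = ∑ j ∈ Finset.univ.filter (fun j => j ≠ i), cauchyC (α i - α j) := by
  have : Nonempty (Fin n) := ⟨⟨0, hn⟩⟩
  have hcast (k : ℕ) (hk : 1 ≤ k) : ((k * (k - 1) : ℕ) : ℝ) = k * (k - 1) := by
    push_cast [Nat.cast_sub hk]
    ring
  obtain ⟨α, hα⟩ := exists_sum_arctan_sub_eq (y := fun i => x i - ((n : ℝ) - 1) / 2)
    (by
      rw [Finset.sum_sub_distrib, htotal, hcast n hn]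
      simp
      ring)
    (fun S hS hS' => by
      have hlt : S.card < n := by simpa using (Finset.card_lt_iff_ne_univ S).2 hS'
      have h := (hstrict S.card hS.card_pos (by omega)).trans_le (hx.sum_filter_lt_card_le S)
      rw [hcast _ hS.card_pos] at h
      simp only [Finset.sum_sub_distrib, Finset.sum_const, nsmul_eq_mul, Fintype.card_fin]
      linarith)
  refine ⟨α, fun i => ?_⟩
  have hi := hα i
  rw [← Finset.add_sum_erase _ _ (Finset.mem_univ i)] at hi
  simp only [sub_self, Real.arctan_zero, zero_div, zero_add] at hi
  rw [Finset.filter_ne']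
  simp only [cauchyC, Finset.sum_add_distrib, ← hi, Finset.sum_const, nsmul_eq_mul,
    Finset.card_erase_of_mem (Finset.mem_univ i), Finset.card_univ, Fintype.card_fin,
    Nat.cast_sub hn]
  push_cast
  ring
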